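/- Suppose |V| = |R × S| = n and K_1 is invertible, and let r_p = (C_p/μ_p)·[1 − (2ν_p/C_p)(√(1 + C_p/ν_p) − 1)]. Let 0 < τ < 1 and suppose φ ∈ ℂ^{R×S} satisfies ‖φ‖_{ℓ^p} < τ r_p. Let η = Σ_{j=1}^∞ 𝒦_j(φ, …, φ) be the sum of the inverse Born series (the true potential with scattering data φ), and let M = sup{‖Σ_{j=1}^∞ 𝒦_j(χ, …, χ)‖_{ℓ^p} : χ ∈ ℂ^{R×S}, ‖χ‖_{ℓ^p} < r_p}. Then for every N ≥ 1, ‖η − Σ_{m=1}^N 𝒦_m(φ, …, φ)‖_{ℓ^∞} ≤ M · (1/(1 − τ))^n · (‖φ‖_{ℓ^p}/(τ r_p))^N · 1/(1 − ‖φ‖_{ℓ^p}/(τ r_p)). -/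

import Mathlib

open scoped ENNReal

/-- The ℓ^p norm of a finitely indexed family, `p ∈ [1, ∞]`. -/
noncomputable def lpNorm (p : ℝ≥0∞) {ι E : Type*} [Fintype ι] [SeminormedAddCommGroup E]
    (f : ι → E) : ℝ :=
  if p = ∞ then ⨆ i, ‖f i‖ else (∑ i, ‖f i‖ ^ p.toReal) ^ (1 / p.toReal)

variable {V R S : Type*} [Fintype V] [DecidableEq V] [Fintype R] [Fintype S]

/-- The multilinear forward Born operator: `bornK α0 B G C j` is `K_j`, mapping
`(η_1, …, η_j)` (given as the first `j` values of an `ℕ`-indexed family) to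
`(r, s) ↦ (−α0)^j (B D_{η_1} G D_{η_2} G ⋯ G D_{η_j} C)(r, s)`; `K_0 := 0` is junk. -/
noncomputable def bornK (α0 : ℝ) (B : Matrix R V ℂ) (G : Matrix V V ℂ) (C : Matrix V S ℂ) :
    ℕ → (ℕ → V → ℂ) → R × S → ℂ
  | 0, _ => 0
  | j + 1, η => fun rs =>
      (-(α0 : ℂ)) ^ (j + 1) *
        (B * Matrix.diagonal (η 0) *
          (List.ofFn fun i : Fin j => G * Matrix.diagonal (η (i.1 + 1))).prod * C) rs.1 rs.2

/-- `μ_p = α0 · max_{v ∈ V} ‖row v of G‖_{ℓ^q}` (this depends only on `q`). -/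
noncomputable def muConst (α0 : ℝ) (q : ℝ≥0∞) (G : Matrix V V ℂ) : ℝ :=
  α0 * ⨆ v : V, lpNorm q (G v)

/-- `ν_p = α0 · (Σ_{r ∈ R} ‖row r of B‖_q^p)^{1/p} · (Σ_{s ∈ S} ‖column s of C‖_q^p)^{1/p}`,
with maxima replacing sums when `p = ∞`. -/
noncomputable def nuConst (α0 : ℝ) (p q : ℝ≥0∞) (B : Matrix R V ℂ) (C : Matrix V S ℂ) : ℝ :=
  α0 * lpNorm p (fun r : R => lpNorm q (B r)) * lpNorm p (fun s : S => lpNorm q fun v => C v s)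

/-- `C_p = min_{‖η‖_p = 1} ‖K_1 η‖_p`. -/
noncomputable def CpConst (p : ℝ≥0∞) (α0 : ℝ) (B : Matrix R V ℂ) (G : Matrix V V ℂ)
    (C : Matrix V S ℂ) : ℝ :=
  sInf {t : ℝ | ∃ η : V → ℂ, lpNorm p η = 1 ∧ t = lpNorm p (bornK α0 B G C 1 fun _ => η)}

/-- Block application for the tensor sum over compositions: given a composition `c` of `j`
and arguments `x : (ℂ^V)^j` (as an `ℕ`-indexed family), `blockK c x` is the `m`-tuple
`(K_{i_1} ⊗ ⋯ ⊗ K_{i_m})(x_1, …, x_j)`, where `m = c.length`, `i_k = c.blocksFun k`, and the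
`k`-th component applies `K_{i_k}` to the consecutive block of arguments of size `i_k`. -/
noncomputable def blockK (α0 : ℝ) (B : Matrix R V ℂ) (G : Matrix V V ℂ) (C : Matrix V S ℂ)
    {j : ℕ} (c : Composition j) (x : ℕ → V → ℂ) : ℕ → R × S → ℂ :=
  fun k =>
    if h : k < c.length then
      bornK α0 B G C (c.blocksFun ⟨k, h⟩) (fun i => x (c.sizeUpTo k + i))
    else 0

/-- The multilinear inverse Born operators: `bornKinv α0 B G C 𝒦₁ j` is `𝒦_j`, where
`𝒦_1 = 𝒦₁` (intended to be `K_1⁻¹`) and, for `j ≥ 2`,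
`𝒦_j = −(Σ_{m=1}^{j−1} 𝒦_m ∘ (Σ_{i_1+⋯+i_m=j, i_k ≥ 1} K_{i_1} ⊗ ⋯ ⊗ K_{i_m})) ∘ (𝒦_1 ⊗ ⋯ ⊗ 𝒦_1)`;
the inner sum over `m` and over `(i_1, …, i_m)` is the sum over all compositions `c` of `j`
with `c.length = m < j`. `𝒦_0 := 0` is junk. -/
noncomputable def bornKinv (α0 : ℝ) (B : Matrix R V ℂ) (G : Matrix V V ℂ) (C : Matrix V S ℂ)
    (K1inv : (R × S → ℂ) → V → ℂ) : ℕ → (ℕ → R × S → ℂ) → V → ℂ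
  | 0 => fun _ => 0
  | 1 => fun x => K1inv (x 0)
  | j + 2 => fun x =>
      -∑ c : Composition (j + 2),
        if h : c.length < j + 2 then
          bornKinv α0 B G C K1inv c.length (blockK α0 B G C c fun i => K1inv (x i))
        else 0
  termination_by j => j
  decreasing_by exact h

/-- The multilinear operator norm `‖T‖_p` of a `j`-multilinear map `T` (taking its arguments
as an `ℕ`-indexed family, only the first `j` of which matter): the smallest constant `t` with
`‖T(x_1, …, x_j)‖_p ≤ t ∏_{i=1}^j ‖x_i‖_p` for all `x`. -/
noncomputable def mulNorm (p : ℝ≥0∞) (j : ℕ) (T : (ℕ → R × S → ℂ) → V → ℂ) : ℝ :=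
  sInf {t : ℝ | ∀ x : ℕ → R × S → ℂ, lpNorm p (T x) ≤ t * ∏ i ∈ Finset.range j, lpNorm p (x i)}

section lpNorm

variable {ι κ E : Type*} [Fintype ι] [Fintype κ] [SeminormedAddCommGroup E]

lemma lpNorm_nonneg (p : ℝ≥0∞) (f : ι → E) : 0 ≤ lpNorm p f := by
  unfold lpNorm
  split_ifs
  · exact Real.iSup_nonneg fun i => norm_nonneg _
  · positivity

lemma lpNorm_eq_norm_toLp (p : ℝ≥0∞) [Fact (1 ≤ p)] (f : ι → E) :
    lpNorm p f = ‖(WithLp.toLp p f : PiLp p fun _ : ι => E)‖ := by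
  unfold lpNorm
  split_ifs with h
  · subst h
    rw [PiLp.norm_eq_ciSup]
  · rw [PiLp.norm_eq_sum]
    exact ENNReal.toReal_pos (zero_lt_one.trans_le Fact.out).ne' h

lemma norm_apply_le_lpNorm (p : ℝ≥0∞) [Fact (1 ≤ p)] (f : ι → E) (i : ι) :
    ‖f i‖ ≤ lpNorm p f := by
  rw [lpNorm_eq_norm_toLp]
  exact PiLp.norm_apply_le (WithLp.toLp p f : PiLp p fun _ : ι => E) i

lemma lpNorm_top_le [Nonempty ι] {f : ι → E} {c : ℝ} (h : ∀ i, ‖f i‖ ≤ c) : lpNorm ∞ f ≤ c := by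
  simpa [lpNorm] using ciSup_le h

lemma lpNorm_le_mul_lpNorm {F : Type*} [SeminormedAddCommGroup F] (p : ℝ≥0∞) [Fact (1 ≤ p)]
    {f : ι → E} {g : ι → F} {c : ℝ} (hc : 0 ≤ c) (h : ∀ i, ‖f i‖ ≤ c * ‖g i‖) :
    lpNorm p f ≤ c * lpNorm p g := by
  have h0 : p ≠ 0 := (zero_lt_one.trans_le Fact.out).ne'
  by_cases hp : p = ∞
  · subst hp
    simp only [lpNorm, if_true]
    exact Real.iSup_le (fun i => (h i).trans
      (mul_le_mul_of_nonneg_left (le_ciSup (f := fun i => ‖g i‖) (Set.finite_range _).bddAbove i)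
        hc)) (mul_nonneg hc (Real.iSup_nonneg fun i => norm_nonneg _))
  · have hp' : 0 < p.toReal := ENNReal.toReal_pos h0 hp
    simp only [lpNorm, if_neg hp]
    calc (∑ i, ‖f i‖ ^ p.toReal) ^ (1 / p.toReal)
        ≤ (∑ i, (c * ‖g i‖) ^ p.toReal) ^ (1 / p.toReal) := by
          gcongr with i
          exact h i
      _ = (c ^ p.toReal * ∑ i, ‖g i‖ ^ p.toReal) ^ (1 / p.toReal) := by
          rw [Finset.mul_sum]
          simp_rw [Real.mul_rpow hc (norm_nonneg _)]
      _ = c * (∑ i, ‖g i‖ ^ p.toReal) ^ (1 / p.toReal) := by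
          rw [Real.mul_rpow (by positivity) (by positivity), ← Real.rpow_mul hc,
            mul_one_div_cancel hp'.ne', Real.rpow_one]

lemma lpNorm_prod_mul_le (p : ℝ≥0∞) [Fact (1 ≤ p)] (f : ι → ℝ) (g : κ → ℝ) :
    lpNorm p (fun x : ι × κ => f x.1 * g x.2) ≤ lpNorm p f * lpNorm p g := by
  have h0 : p ≠ 0 := (zero_lt_one.trans_le Fact.out).ne'
  by_cases hp : p = ∞
  · subst hp
    have hf := norm_apply_le_lpNorm ∞ f
    have hg := norm_apply_le_lpNorm ∞ g
    have hf0 := lpNorm_nonneg ∞ f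
    have hg0 := lpNorm_nonneg ∞ g
    simp only [lpNorm, if_true] at hf hg hf0 hg0 ⊢
    refine Real.iSup_le (fun x => ?_) (by positivity)
    rw [norm_mul]
    exact mul_le_mul (hf _) (hg _) (norm_nonneg _) hf0
  · simp only [lpNorm, if_neg hp]
    rw [← Real.mul_rpow (by positivity) (by positivity), Finset.sum_mul_sum, Fintype.sum_prod_type]
    simp_rw [norm_mul, Real.mul_rpow (norm_nonneg _) (norm_nonneg _)]
    rfl

/-- Hölder's inequality for finite sums, including the endpoint exponents. -/
lemma norm_sum_mul_le_lpNorm_mul_lpNorm {p q : ℝ≥0∞} (hp : 1 ≤ p) (hq : 1 ≤ q)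
    (hpq : 1 / p + 1 / q = 1) (f g : ι → ℂ) :
    ‖∑ i, f i * g i‖ ≤ lpNorm q f * lpNorm p g := by
  have : Fact (1 ≤ p) := ⟨hp⟩
  have : Fact (1 ≤ q) := ⟨hq⟩
  have key : ‖∑ i, f i * g i‖ ≤ ∑ i, ‖f i‖ * ‖g i‖ := by
    simpa only [norm_mul] using norm_sum_le Finset.univ fun i => f i * g i
  refine key.trans ?_
  by_cases hpt : p = ∞
  · subst hpt
    have hq1 : q = 1 := by simpa using hpq
    subst hq1
    calc ∑ i, ‖f i‖ * ‖g i‖ ≤ ∑ i, ‖f i‖ * lpNorm ∞ g := by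
          gcongr with i
          exact norm_apply_le_lpNorm _ _ _
      _ = lpNorm 1 f * lpNorm ∞ g := by rw [← Finset.sum_mul]; simp [lpNorm]
  by_cases hqt : q = ∞
  · subst hqt
    have hp1 : p = 1 := by simpa using hpq
    subst hp1
    calc ∑ i, ‖f i‖ * ‖g i‖ ≤ ∑ i, lpNorm ∞ f * ‖g i‖ := by
          gcongr with i
          exact norm_apply_le_lpNorm _ _ _
      _ = lpNorm ∞ f * lpNorm 1 g := by rw [← Finset.mul_sum]; simp [lpNorm]
  have hconj : q.toReal.HolderConjugate p.toReal := by
    have : q.HolderConjugate p := by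
      rw [ENNReal.holderConjugate_iff, add_comm]
      simpa only [one_div] using hpq
    exact ENNReal.HolderConjugate.toReal_of_ne_top hqt hpt
  have := Real.inner_le_Lp_mul_Lq Finset.univ (fun i => ‖f i‖) (fun i => ‖g i‖) hconj
  simpa only [lpNorm, if_neg hpt, if_neg hqt, abs_norm] using this

end lpNorm

/-- Cauchy's estimate for the coefficients of a convergent power series. -/
lemma norm_coeff_mul_pow_le_of_forall_norm_tsum_le {E : Type*} [NormedAddCommGroup E]
    [NormedSpace ℂ E] [CompleteSpace E] {a : ℕ → E} {r r' M : ℝ} (hr : 0 < r) (hrr' : r < r')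
    (ha : Summable fun n => ‖a n‖ * r' ^ n)
    (hM : ∀ z : ℂ, ‖z‖ = r → ‖∑' n, z ^ n • a n‖ ≤ M) (n : ℕ) :
    ‖a n‖ * r ^ n ≤ M := by
  let P : FormalMultilinearSeries ℂ ℂ E :=
    fun n => ContinuousMultilinearMap.mkPiRing ℂ (Fin n) (a n)
  have hr' : 0 < r' := hr.trans hrr'
  have hrad : (r'.toNNReal : ℝ≥0∞) ≤ P.radius := by
    apply P.le_radius_of_summable_norm
    simpa [P, Real.coe_toNNReal _ hr'.le] using ha
  have hpos : (0 : ℝ≥0∞) < (r'.toNNReal : ℝ≥0∞) := by simpa using hr'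
  have hP := (P.hasFPowerSeriesOnBall (hpos.trans_le hrad)).mono hpos hrad
  have hsum : ∀ z, P.sum z = ∑' n, z ^ n • a n := fun z => by
    simp [FormalMultilinearSeries.sum, P]
  have hd : DiffContOnCl ℂ P.sum (Metric.ball 0 r) := by
    apply DifferentiableOn.diffContOnCl
    refine hP.differentiableOn.mono ?_
    rw [closure_ball _ hr.ne']
    intro z hz
    simp only [Metric.mem_closedBall, dist_zero_right] at hz
    rw [Metric.mem_eball, edist_zero_right, ← ofReal_norm]
    exact (ENNReal.ofReal_lt_ofReal_iff hr').2 (hz.trans_lt hrr')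
  have h1 := Complex.norm_iteratedDeriv_le_of_forall_mem_sphere_norm_le n hr hd (C := M)
    (fun z hz => by rw [hsum]; exact hM z (by simpa using hz))
  have h2 : iteratedDeriv n P.sum 0 = n.factorial • a n := by
    have := hP.factorial_smul (1 : ℂ) n
    rw [iteratedDeriv_eq_iteratedFDeriv, ← this]
    simp [P]
  have hfac : (0 : ℝ) < n.factorial := by positivity
  rw [h2, ← Nat.cast_smul_eq_nsmul ℂ, norm_smul, Complex.norm_natCast, mul_div_assoc,
    mul_le_mul_iff_right₀ hfac, le_div_iff₀ (by positivity)] at h1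
  exact h1

/-- A majorant for the coefficients of the inverse of a formal multilinear series whose
coefficients grow geometrically. -/
lemma sum_pow_mul_norm_rightInv_le {E F : Type*} [NormedAddCommGroup E] [NormedSpace ℂ E]
    [NormedAddCommGroup F] [NormedSpace ℂ F] (P : FormalMultilinearSeries ℂ E F) (i : E ≃L[ℂ] F)
    {mu nu c r b : ℝ} (hmu : 0 < mu) (hnu : 0 < nu) (hc : 0 < c)
    (hP : ∀ n, ‖P n‖ ≤ nu / mu * mu ^ n) (hi : ‖(i.symm : F →L[ℂ] E)‖ ≤ 1 / c)
    (hr : 0 ≤ r) (hb0 : 0 ≤ b) (hb1 : mu * b < 1)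
    (hb : r / c + nu / c * (mu * b ^ 2) / (1 - mu * b) ≤ b) (n : ℕ) :
    ∑ k ∈ Finset.Ico 1 (n + 1), r ^ k * ‖P.rightInv i 0 k‖ ≤ b := by
  induction n with
  | zero => simpa using hb0
  | succ n ih =>
    refine (FormalMultilinearSeries.radius_rightInv_pos_of_radius_pos_aux2 (by lia) P i hmu.le hr
      (by positivity) hP).trans (le_trans ?_ hb)
    set s := ∑ k ∈ Finset.Ico 1 (n + 1), r ^ k * ‖P.rightInv i 0 k‖
    have hs : 0 ≤ s := Finset.sum_nonneg fun k _ => by positivity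
    have hgeom : ∑ k ∈ Finset.Ico 2 (n + 1 + 1), (mu * s) ^ k ≤ (mu * b) ^ 2 / (1 - mu * b) :=
      calc ∑ k ∈ Finset.Ico 2 (n + 1 + 1), (mu * s) ^ k
          ≤ ∑ k ∈ Finset.Ico 2 (n + 1 + 1), (mu * b) ^ k := by gcongr
        _ ≤ _ := geom_sum_Ico_le_of_lt_one (by positivity) hb1
    calc _ ≤ 1 / c * r + 1 / c * (nu / mu) * ((mu * b) ^ 2 / (1 - mu * b)) := by
          gcongr
      _ = _ := by
          have : 1 - mu * b ≠ 0 := by linarith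
          field_simp

lemma mulVec_diagonal_prod_lpNorm_le {p q : ℝ≥0∞} (hp : 1 ≤ p) (hq : 1 ≤ q)
    (hpq : 1 / p + 1 / q = 1) (G : Matrix V V ℂ) (c : V → ℂ) (n : ℕ) (η : ℕ → V → ℂ) :
    lpNorm p ((Matrix.diagonal (η 0) *
        (List.ofFn fun i : Fin n => G * Matrix.diagonal (η (i.1 + 1))).prod).mulVec c) ≤
      (⨆ v, lpNorm q (G v)) ^ n * (∏ i ∈ Finset.range (n + 1), lpNorm p (η i)) * lpNorm q c := by
  have : Fact (1 ≤ p) := ⟨hp⟩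
  have : Fact (1 ≤ q) := ⟨hq⟩
  have hg : 0 ≤ ⨆ v, lpNorm q (G v) := Real.iSup_nonneg fun v => lpNorm_nonneg _ _
  induction n generalizing η with
  | zero =>
    simp only [List.ofFn_zero, List.prod_nil, mul_one, pow_zero, one_mul, zero_add,
      Finset.prod_range_one]
    rw [mul_comm]
    refine lpNorm_le_mul_lpNorm p (lpNorm_nonneg _ _) fun v => ?_
    rw [Matrix.mulVec_diagonal, norm_mul, mul_comm]
    exact mul_le_mul_of_nonneg_right (norm_apply_le_lpNorm q c v) (norm_nonneg _)
  | succ n ih =>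
    set w := (Matrix.diagonal (η 1) *
      (List.ofFn fun i : Fin n => G * Matrix.diagonal (η (i.1 + 1 + 1))).prod).mulVec c with hw
    have hsplit : (Matrix.diagonal (η 0) *
        (List.ofFn fun i : Fin (n + 1) => G * Matrix.diagonal (η (i.1 + 1))).prod).mulVec c =
        fun v => η 0 v * ∑ u, G v u * w u := by
      rw [List.ofFn_succ, List.prod_cons]
      simp only [Fin.val_zero, Fin.val_succ, zero_add]
      rw [mul_assoc, ← Matrix.mulVec_mulVec, ← Matrix.mulVec_mulVec, ← hw]
      ext v
      rw [Matrix.mulVec_diagonal]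
      rfl
    rw [hsplit]
    have hw' := ih fun i => η (i + 1)
    calc lpNorm p (fun v => η 0 v * ∑ u, G v u * w u)
        ≤ ((⨆ v, lpNorm q (G v)) * lpNorm p w) * lpNorm p (η 0) := by
          refine lpNorm_le_mul_lpNorm p (mul_nonneg hg (lpNorm_nonneg _ _)) fun v => ?_
          rw [norm_mul, mul_comm]
          refine mul_le_mul_of_nonneg_right ?_ (norm_nonneg _)
          refine (norm_sum_mul_le_lpNorm_mul_lpNorm hp hq hpq _ _).trans ?_
          exact mul_le_mul_of_nonneg_right
            (le_ciSup (f := fun v => lpNorm q (G v)) (Set.finite_range _).bddAbove v)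
            (lpNorm_nonneg _ _)
      _ ≤ ((⨆ v, lpNorm q (G v)) * ((⨆ v, lpNorm q (G v)) ^ n *
            (∏ i ∈ Finset.range (n + 1), lpNorm p (η (i + 1))) * lpNorm q c)) *
            lpNorm p (η 0) := by
          have := lpNorm_nonneg p (η 0)
          gcongr
      _ = _ := by rw [Finset.prod_range_succ' _ (n + 1)]; ring

lemma bornK_succ_apply (α0 : ℝ) (B : Matrix R V ℂ) (G : Matrix V V ℂ) (C : Matrix V S ℂ) (n : ℕ)
    (η : ℕ → V → ℂ) (r : R) (s : S) :
    bornK α0 B G C (n + 1) η (r, s) = (-(α0 : ℂ)) ^ (n + 1) * ∑ u, B r u *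
      (Matrix.diagonal (η 0) * (List.ofFn fun i : Fin n =>
        G * Matrix.diagonal (η (i.1 + 1))).prod).mulVec (fun v => C v s) u := by
  rw [bornK, Matrix.mul_assoc B, Matrix.mul_assoc B]
  rfl

lemma lpNorm_bornK_succ_le {p q : ℝ≥0∞} (hp : 1 ≤ p) (hq : 1 ≤ q) (hpq : 1 / p + 1 / q = 1)
    {α0 : ℝ} (hα0 : 0 < α0) (B : Matrix R V ℂ) (G : Matrix V V ℂ) (C : Matrix V S ℂ) (n : ℕ)
    (η : ℕ → V → ℂ) :
    lpNorm p (bornK α0 B G C (n + 1) η) ≤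
      nuConst α0 p q B C * muConst α0 q G ^ n * ∏ i ∈ Finset.range (n + 1), lpNorm p (η i) := by
  have : Fact (1 ≤ p) := ⟨hp⟩
  have hg : 0 ≤ ⨆ v, lpNorm q (G v) := Real.iSup_nonneg fun v => lpNorm_nonneg _ _
  have hη : 0 ≤ ∏ i ∈ Finset.range (n + 1), lpNorm p (η i) :=
    Finset.prod_nonneg fun i _ => lpNorm_nonneg _ _
  have hw := mulVec_diagonal_prod_lpNorm_le hp hq hpq G
  rw [nuConst, muConst]
  generalize (⨆ v, lpNorm q (G v)) = g at *
  obtain ⟨c, hc⟩ : ∃ c, c = α0 ^ (n + 1) * (g ^ n * ∏ i ∈ Finset.range (n + 1), lpNorm p (η i)) :=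
    ⟨_, rfl⟩
  have hc0 : 0 ≤ c := by rw [hc]; positivity
  have h1 : lpNorm p (bornK α0 B G C (n + 1) η) ≤ c * lpNorm p (fun x : R × S =>
      lpNorm q (B x.1) * lpNorm q fun v => C v x.2) := by
    refine lpNorm_le_mul_lpNorm p hc0 ?_
    rintro ⟨r, s⟩
    have hB := lpNorm_nonneg q (B r)
    have hC := lpNorm_nonneg q (fun v => C v s)
    rw [bornK_succ_apply, norm_mul, norm_pow, norm_neg, Complex.norm_real,
      Real.norm_of_nonneg hα0.le, Real.norm_of_nonneg (mul_nonneg hB hC)]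
    have h2 := (norm_sum_mul_le_lpNorm_mul_lpNorm hp hq hpq (B r) _).trans
      (mul_le_mul_of_nonneg_left (hw (fun v => C v s) n η) hB)
    refine (mul_le_mul_of_nonneg_left h2 (by positivity)).trans_eq ?_
    rw [hc]
    ring
  have h2 := lpNorm_prod_mul_le p (fun r : R => lpNorm q (B r))
    (fun s : S => lpNorm q fun v => C v s)
  refine h1.trans ((mul_le_mul_of_nonneg_left h2 hc0).trans_eq ?_)
  rw [hc, mul_pow]
  ring

/-- The `K_j` as the coefficients of a formal multilinear series. -/
lemma exists_formalMultilinearSeries_bornK {p q : ℝ≥0∞} [hp : Fact (1 ≤ p)] (hq : 1 ≤ q)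
    (hpq : 1 / p + 1 / q = 1) {α0 : ℝ} (hα0 : 0 < α0) (B : Matrix R V ℂ) (G : Matrix V V ℂ)
    (C : Matrix V S ℂ) (hmu : 0 < muConst α0 q G) :
    ∃ P : FormalMultilinearSeries ℂ (PiLp p fun _ : V => ℂ) (PiLp p fun _ : R × S => ℂ),
      (∀ (n : ℕ) (η : ℕ → V → ℂ),
        P n (fun k => WithLp.toLp p (η k)) = WithLp.toLp p (bornK α0 B G C n η)) ∧
      ∀ n, ‖P n‖ ≤ nuConst α0 p q B C / muConst α0 q G * muConst α0 q G ^ n := by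
  have hnu : 0 ≤ nuConst α0 p q B C :=
    mul_nonneg (mul_nonneg hα0.le (lpNorm_nonneg _ _)) (lpNorm_nonneg _ _)
  suffices h : ∀ n, ∃ T : ContinuousMultilinearMap ℂ (fun _ : Fin n => PiLp p fun _ : V => ℂ)
      (PiLp p fun _ : R × S => ℂ),
      (∀ η : ℕ → V → ℂ, T (fun k => WithLp.toLp p (η k)) = WithLp.toLp p (bornK α0 B G C n η)) ∧
      ‖T‖ ≤ nuConst α0 p q B C / muConst α0 q G * muConst α0 q G ^ n by
    choose P hP using h
    exact ⟨P, fun n => (hP n).1, fun n => (hP n).2⟩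
  intro n
  cases n with
  | zero => exact ⟨0, fun η => by simp [bornK], by rw [norm_zero]; positivity⟩
  | succ n =>
    let L : Matrix V V ℂ →ₗ[ℂ] PiLp p fun _ : R × S => ℂ :=
      { toFun := fun M => WithLp.toLp p fun rs => (-(α0 : ℂ)) ^ (n + 1) * (B * M * C) rs.1 rs.2
        map_add' := fun M M' => by
          ext rs
          simp [Matrix.mul_add, Matrix.add_mul, mul_add]
        map_smul' := fun z M => by
          ext rs
          simp [mul_left_comm] }
    let D : Fin (n + 1) → (PiLp p fun _ : V => ℂ) →ₗ[ℂ] Matrix V V ℂ := fun i =>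
      { toFun := fun η => (if i = 0 then 1 else G) * Matrix.diagonal (WithLp.ofLp η)
        map_add' := fun η η' => by
          rw [← mul_add, Matrix.diagonal_add]
          rfl
        map_smul' := fun z η => by
          rw [WithLp.ofLp_smul, Matrix.diagonal_smul, Matrix.mul_smul, RingHom.id_apply] }
    let T := L.compMultilinearMap
      ((MultilinearMap.mkPiAlgebraFin ℂ (n + 1) (Matrix V V ℂ)).compLinearMap D)
    have hT : ∀ η : ℕ → V → ℂ, T (fun k => WithLp.toLp p (η k)) =
        WithLp.toLp p (bornK α0 B G C (n + 1) η) := fun η => by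
      simp [T, L, D, bornK, List.ofFn_succ, Matrix.mul_assoc]
    have hbound : ∀ v, ‖T v‖ ≤ nuConst α0 p q B C * muConst α0 q G ^ n * ∏ i, ‖v i‖ := fun v => by
      let η : ℕ → V → ℂ := fun i => if h : i < n + 1 then WithLp.ofLp (v ⟨i, h⟩) else 0
      have hv : v = fun k : Fin (n + 1) => WithLp.toLp p (η k) := by
        ext k : 1
        simp only [η, k.isLt, dif_pos, WithLp.toLp_ofLp]
      rw [hv, hT, ← lpNorm_eq_norm_toLp]
      simp_rw [← lpNorm_eq_norm_toLp]
      rw [Fin.prod_univ_eq_prod_range fun i => lpNorm p (η i)]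
      exact lpNorm_bornK_succ_le hp.out hq hpq hα0 B G C n η
    refine ⟨T.mkContinuous _ hbound, hT, (T.mkContinuous_norm_le (by positivity) hbound).trans_eq ?_⟩
    rw [pow_succ]
    field_simp

/-- The `𝒦_j` are the coefficients of the left inverse of the forward Born series. -/
lemma leftInv_apply_eq_bornKinv {p : ℝ≥0∞} [Fact (1 ≤ p)] {α0 : ℝ} {B : Matrix R V ℂ}
    {G : Matrix V V ℂ} {C : Matrix V S ℂ} {K1inv : (R × S → ℂ) → V → ℂ}
    {P : FormalMultilinearSeries ℂ (PiLp p fun _ : V => ℂ) (PiLp p fun _ : R × S => ℂ)}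
    (hP : ∀ (n : ℕ) (η : ℕ → V → ℂ),
      P n (fun k => WithLp.toLp p (η k)) = WithLp.toLp p (bornK α0 B G C n η))
    {e : (PiLp p fun _ : V => ℂ) ≃L[ℂ] PiLp p fun _ : R × S => ℂ}
    (he : ∀ x, e.symm (WithLp.toLp p x) = WithLp.toLp p (K1inv x)) (n : ℕ)
    (x : ℕ → R × S → ℂ) :
    P.leftInv e 0 n (fun k => WithLp.toLp p (x k)) =
      WithLp.toLp p (bornKinv α0 B G C K1inv n x) := by
  induction n using Nat.strong_induction_on generalizing x with
  | _ n ih =>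
    match n with
    | 0 => simp [bornKinv]
    | 1 => simp [bornKinv, he]
    | n + 2 =>
      let f : Composition (n + 2) → PiLp p fun _ : V => ℂ := fun c => WithLp.toLp p
        (if h : c.length < n + 2 then
          bornKinv α0 B G C K1inv c.length (blockK α0 B G C c fun i => K1inv (x i))
        else 0)
      have hf : ∑ c : { c : Composition (n + 2) // c.length < n + 2 }, f c = ∑ c, f c := by
        rw [← Finset.sum_subtype (Finset.univ.filter fun c : Composition (n + 2) =>
          c.length < n + 2) (by simp) f]
        refine Finset.sum_filter_of_ne fun c _ hc => ?_
        by_contra hlt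
        exact hc (by simp [f, hlt])
      rw [FormalMultilinearSeries.leftInv, bornKinv, WithLp.toLp_neg, WithLp.toLp_sum, ← hf,
        neg_apply, sum_apply]
      congr 1
      refine Finset.sum_congr rfl fun c _ => ?_
      simp only [f, dif_pos c.2]
      rw [← ih _ c.2]
      refine congrArg (P.leftInv e 0 c.1.length) (funext fun k => ?_)
      simp only [blockK, dif_pos k.isLt]
      rw [← hP]
      simp only [FormalMultilinearSeries.applyComposition]
      refine congrArg (P (c.1.blocksFun k)) (funext fun j => ?_)
      simp [he]

/-- At the radius of convergence the majorant equation has an explicit fixed point. -/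
lemma exists_majorant_fixedPoint {mu nu c r : ℝ} (hmu : 0 < mu) (hnu : 0 < nu) (hc : 0 < c)
    (hr : r = c / mu * (1 - 2 * nu / c * (Real.sqrt (1 + c / nu) - 1))) :
    ∃ b, 0 ≤ b ∧ mu * b < 1 ∧ r / c + nu / c * (mu * b ^ 2) / (1 - mu * b) ≤ b := by
  obtain ⟨t, ht⟩ : ∃ t, t = Real.sqrt (1 + c / nu) := ⟨_, rfl⟩
  have ht1 : 1 < t := by
    rw [ht, Real.lt_sqrt zero_le_one]
    have : 0 < c / nu := by positivity
    linarith
  have hct : c = nu * (t ^ 2 - 1) := by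
    rw [ht, Real.sq_sqrt (by positivity)]
    field_simp
    ring
  have ht0 : 0 < t := by linarith
  have ht2 : 0 < t - 1 := by linarith
  have ht3 : t ^ 2 - 1 ≠ 0 := by nlinarith
  rw [← ht] at hr
  have h1 : 1 - mu * ((t - 1) / (mu * t)) = 1 / t := by field_simp; ring
  refine ⟨(t - 1) / (mu * t), by positivity, ?_, le_of_eq ?_⟩
  · have : 0 < 1 / t := by positivity
    linarith
  · rw [h1, hr, hct]
    field_simp
    ring

lemma exists_continuousLinearEquiv_bornK_one {p : ℝ≥0∞} [Fact (1 ≤ p)] {α0 : ℝ} {B : Matrix R V ℂ}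
    {G : Matrix V V ℂ} {C : Matrix V S ℂ} {K1inv : (R × S → ℂ) → V → ℂ}
    (hleft : ∀ η : V → ℂ, K1inv (bornK α0 B G C 1 fun _ => η) = η)
    (hright : ∀ φ : R × S → ℂ, bornK α0 B G C 1 (fun _ => K1inv φ) = φ)
    {P : FormalMultilinearSeries ℂ (PiLp p fun _ : V => ℂ) (PiLp p fun _ : R × S => ℂ)}
    (hP : ∀ (n : ℕ) (η : ℕ → V → ℂ),
      P n (fun k => WithLp.toLp p (η k)) = WithLp.toLp p (bornK α0 B G C n η)) :
    ∃ e : (PiLp p fun _ : V => ℂ) ≃L[ℂ] PiLp p fun _ : R × S => ℂ,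
      (∀ x, e.symm (WithLp.toLp p x) = WithLp.toLp p (K1inv x)) ∧
      P 1 = (continuousMultilinearCurryFin1 ℂ (PiLp p fun _ : V => ℂ)
        (PiLp p fun _ : R × S => ℂ)).symm e := by
  let f := continuousMultilinearCurryFin1 ℂ (PiLp p fun _ : V => ℂ)
    (PiLp p fun _ : R × S => ℂ) (P 1)
  have hf : ∀ η : V → ℂ,
      f (WithLp.toLp p η) = WithLp.toLp p (bornK α0 B G C 1 fun _ => η) := fun η => by
    rw [← hP]
    simp only [f, continuousMultilinearCurryFin1_apply]
    congr 1
  let e : (PiLp p fun _ : V => ℂ) ≃ₗ[ℂ] PiLp p fun _ : R × S => ℂ :=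
    { (f : (PiLp p fun _ : V => ℂ) →ₗ[ℂ] PiLp p fun _ : R × S => ℂ) with
      invFun := fun x => WithLp.toLp p (K1inv (WithLp.ofLp x))
      left_inv := fun x => by
        change WithLp.toLp p (K1inv (WithLp.ofLp (f (WithLp.toLp p (WithLp.ofLp x))))) = x
        rw [hf, hleft]
      right_inv := fun x => by
        change f (WithLp.toLp p (K1inv (WithLp.ofLp x))) = x
        rw [hf, hright] }
  refine ⟨e.toContinuousLinearEquiv, fun x => rfl, ?_⟩
  rw [LinearIsometryEquiv.eq_symm_apply]
  rfl

lemma CpConst_mul_norm_le {p : ℝ≥0∞} [Fact (1 ≤ p)] {α0 : ℝ} {B : Matrix R V ℂ}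
    {G : Matrix V V ℂ} {C : Matrix V S ℂ}
    (f : (PiLp p fun _ : V => ℂ) →L[ℂ] PiLp p fun _ : R × S => ℂ)
    (hf : ∀ η, f (WithLp.toLp p η) = WithLp.toLp p (bornK α0 B G C 1 fun _ => η))
    (η : PiLp p fun _ : V => ℂ) : CpConst p α0 B G C * ‖η‖ ≤ ‖f η‖ := by
  obtain h0 | h0 := eq_or_ne η 0
  · simp [h0]
  have hη : 0 < ‖η‖ := norm_pos_iff.2 h0
  rw [← le_div_iff₀ hη]
  refine csInf_le ⟨0, ?_⟩ ⟨WithLp.ofLp ((‖η‖⁻¹ : ℂ) • η), ?_, ?_⟩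
  · rintro t ⟨η', -, rfl⟩
    exact lpNorm_nonneg _ _
  · rw [lpNorm_eq_norm_toLp, WithLp.toLp_ofLp, norm_smul, norm_inv, Complex.norm_real, norm_norm,
      inv_mul_cancel₀ hη.ne']
  · rw [lpNorm_eq_norm_toLp, ← hf, WithLp.toLp_ofLp, map_smul, norm_smul, norm_inv,
      Complex.norm_real, norm_norm, div_eq_inv_mul]

/-- Truncation error of a formal multilinear series on the diagonal, from a bound of its sum. -/
lemma norm_tsum_sub_sum_range_le {E F : Type*} [NormedAddCommGroup E] [NormedSpace ℂ E]
    [CompleteSpace E] [NormedAddCommGroup F] [NormedSpace ℂ F] (Q : FormalMultilinearSeries ℂ F E)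
    (hQ0 : Q 0 = 0) {r M τ : ℝ} (hr : 0 < r) (hτ0 : 0 < τ) (hτ1 : τ < 1)
    (hQ : Summable fun n => ‖Q n‖ * r ^ n)
    (hM : ∀ χ : F, ‖χ‖ < r → ‖∑' j, Q (j + 1) fun _ => χ‖ ≤ M) {φ : F} (hφ : ‖φ‖ < τ * r)
    (N : ℕ) :
    ‖(∑' j, Q (j + 1) fun _ => φ) - ∑ m ∈ Finset.range N, Q (m + 1) fun _ => φ‖ ≤
      M * (‖φ‖ / (τ * r)) ^ N * (1 / (1 - ‖φ‖ / (τ * r))) := by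
  have hM0 : 0 ≤ M := (norm_nonneg _).trans (hM 0 (by simpa using hr))
  have hτr : 0 < τ * r := mul_pos hτ0 hr
  have hle : ∀ n (χ : F), ‖Q n fun _ => χ‖ ≤ ‖Q n‖ * ‖χ‖ ^ n := fun n χ => by
    simpa using (Q n).le_opNorm fun _ => χ
  have hφr : ‖φ‖ < r := hφ.trans (by nlinarith)
  have hsum : Summable fun n => Q n fun _ => φ :=
    Summable.of_norm_bounded hQ fun n => (hle n φ).trans (by gcongr)
  obtain ⟨s, hs⟩ : ∃ s, s = ‖φ‖ / (τ * r) := ⟨_, rfl⟩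
  have hs0 : 0 ≤ s := by rw [hs]; positivity
  have hs1 : s < 1 := by rw [hs]; exact (div_lt_one hτr).2 hφ
  have hcoeff : ∀ n, ‖Q (n + 1) fun _ => φ‖ ≤ M * s ^ (n + 1) := fun n => by
    obtain h0 | h0 := (norm_nonneg φ).eq_or_lt
    · refine (hle _ _).trans_eq ?_
      rw [hs, ← h0]
      simp
    have hs' : 0 < s := by rw [hs]; positivity
    have h1 : 1 / s < r / ‖φ‖ := by
      rw [hs, one_div_div]
      gcongr
      nlinarith
    have h2 : ∀ z : ℂ, ‖z‖ = 1 / s → ‖∑' n, z ^ n • Q n fun _ => φ‖ ≤ M := fun z hz => by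
      have hz' : ‖z • φ‖ = τ * r := by
        rw [norm_smul, hz, hs]
        field_simp
      have hterm : ∀ n, (Q n fun _ => z • φ) = z ^ n • Q n fun _ => φ := fun n => by
        simpa using (Q n).map_smul_univ (fun _ => z) fun _ => φ
      have hzr : ‖z • φ‖ < r := by rw [hz']; nlinarith
      have hsz : Summable fun n => Q n fun _ => z • φ :=
        Summable.of_norm_bounded hQ fun n => (hle n _).trans (by gcongr)
      simp_rw [← hterm]
      rw [hsz.tsum_eq_zero_add, hQ0]
      simpa using hM _ hzr
    have h3 := norm_coeff_mul_pow_le_of_forall_norm_tsum_le (a := fun n => Q n fun _ => φ)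
      (by positivity) h1 (Summable.of_nonneg_of_le (fun n => by positivity) (fun n => ?_) hQ) h2
      (n + 1)
    · rw [one_div, inv_pow, ← div_eq_mul_inv, div_le_iff₀ (by positivity)] at h3
      exact h3
    · calc ‖Q n fun _ => φ‖ * (r / ‖φ‖) ^ n ≤ (‖Q n‖ * ‖φ‖ ^ n) * (r / ‖φ‖) ^ n := by
            gcongr
            exact hle n φ
        _ = ‖Q n‖ * r ^ n := by
            rw [mul_assoc, ← mul_pow, mul_div_cancel₀ _ h0.ne']
  have htail := ((summable_nat_add_iff 1).2 hsum).sum_add_tsum_nat_add N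
  rw [← htail, add_sub_cancel_left, ← hs]
  have hgeom : HasSum (fun j : ℕ => M * s ^ N * s ^ j) (M * s ^ N * (1 / (1 - s))) := by
    rw [one_div]
    exact (hasSum_geometric_of_lt_one hs0 hs1).mul_left _
  refine tsum_of_norm_bounded hgeom fun j => (hcoeff (j + N)).trans ?_
  rw [mul_assoc, ← pow_add]
  gcongr ?_ * ?_
  exact pow_le_pow_of_le_one hs0 hs1.le (by lia)

/- STATEMENT 11: Truncation error. If `|V| = |R × S| = n`, `K_1` is invertible with inverse
`𝒦_1`, `0 < τ < 1`, `‖φ‖_p < τ r_p`, `η = Σ_{j=1}^∞ 𝒦_j(φ, …, φ)`, and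
`M = sup {‖Σ_{j=1}^∞ 𝒦_j(χ, …, χ)‖_p : ‖χ‖_p < r_p}`, then for every `N ≥ 1`,
`‖η − Σ_{m=1}^N 𝒦_m(φ, …, φ)‖_∞ ≤ M (1/(1−τ))^n (‖φ‖_p/(τ r_p))^N / (1 − ‖φ‖_p/(τ r_p))`. -/
theorem inverse_born_truncation_error [Nonempty V] [Nonempty R] [Nonempty S]
    (p q : ℝ≥0∞) (hp : 1 ≤ p) (hq : 1 ≤ q) (hpq : 1 / p + 1 / q = 1)
    (α0 : ℝ) (hα0 : 0 < α0) (B : Matrix R V ℂ) (G : Matrix V V ℂ) (C : Matrix V S ℂ)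
    (hcard : Fintype.card V = Fintype.card (R × S))
    (K1inv : (R × S → ℂ) → V → ℂ)
    (hleft : ∀ η : V → ℂ, K1inv (bornK α0 B G C 1 fun _ => η) = η)
    (hright : ∀ φ : R × S → ℂ, bornK α0 B G C 1 (fun _ => K1inv φ) = φ)
    (mu nu Cp rp : ℝ) (hmu : mu = muConst α0 q G) (hnu : nu = nuConst α0 p q B C)
    (hCp : Cp = CpConst p α0 B G C)
    (hrp : rp = Cp / mu * (1 - 2 * nu / Cp * (Real.sqrt (1 + Cp / nu) - 1)))
    (τ : ℝ) (hτ0 : 0 < τ) (hτ1 : τ < 1)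
    (φ : R × S → ℂ) (hφ : lpNorm p φ < τ * rp)
    (M : ℝ)
    (hM : M = sSup {t : ℝ | ∃ χ : R × S → ℂ, lpNorm p χ < rp ∧
        t = lpNorm p (∑' j : ℕ, bornKinv α0 B G C K1inv (j + 1) fun _ => χ)})
    (N : ℕ) (hN : 1 ≤ N) :
    lpNorm ∞ ((∑' j : ℕ, bornKinv α0 B G C K1inv (j + 1) fun _ => φ) -
        ∑ m ∈ Finset.range N, bornKinv α0 B G C K1inv (m + 1) fun _ => φ) ≤
      M * (1 / (1 - τ)) ^ Fintype.card V * (lpNorm p φ / (τ * rp)) ^ N *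
        (1 / (1 - lpNorm p φ / (τ * rp))) := by
  have : Fact (1 ≤ p) := ⟨hp⟩
  have hrp0 : 0 < rp := by
    have := (lpNorm_nonneg p φ).trans_lt hφ
    exact (pos_iff_pos_of_mul_pos this).1 hτ0
  have hmu0 : 0 < mu := by
    refine lt_of_le_of_ne ?_ fun h => hrp0.ne' (by rw [hrp, ← h]; simp)
    rw [hmu]
    exact mul_nonneg hα0.le (Real.iSup_nonneg fun v => lpNorm_nonneg _ _)
  have hCp0 : 0 < Cp := by
    refine lt_of_le_of_ne ?_ fun h => hrp0.ne' (by rw [hrp, ← h]; simp)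
    rw [hCp]
    refine Real.sInf_nonneg ?_
    rintro t ⟨η, -, rfl⟩
    exact lpNorm_nonneg _ _
  obtain ⟨P, hP, hPnorm⟩ := exists_formalMultilinearSeries_bornK hq hpq hα0 B G C (hmu ▸ hmu0)
  obtain ⟨e, he, hP1⟩ := exists_continuousLinearEquiv_bornK_one hleft hright hP
  have heK : ∀ η, e (WithLp.toLp p η) = WithLp.toLp p (bornK α0 B G C 1 fun _ => η) := fun η => by
    rw [← hP, hP1]
    simp
  have hlower : ∀ η, Cp * ‖η‖ ≤ ‖e η‖ := fun η => by
    rw [hCp]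
    exact CpConst_mul_norm_le (e : (PiLp p fun _ : V => ℂ) →L[ℂ] PiLp p fun _ : R × S => ℂ) heK η
  have hnu0 : 0 < nu := by
    have h1 := lpNorm_bornK_succ_le hp hq hpq hα0 B G C 0 fun _ => (fun _ => 1 : V → ℂ)
    have h2 := hlower (WithLp.toLp p fun _ => 1)
    rw [heK, ← lpNorm_eq_norm_toLp, ← lpNorm_eq_norm_toLp] at h2
    have h3 : 0 < lpNorm p (fun _ => 1 : V → ℂ) := by
      have := norm_apply_le_lpNorm p (fun _ => 1 : V → ℂ) (Classical.arbitrary V)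
      rw [norm_one] at this
      linarith
    rw [← hnu] at h1
    simp only [zero_add, pow_zero, mul_one, Finset.prod_range_one] at h1
    exact hCp0.trans_le (le_of_mul_le_mul_right (h2.trans h1) h3)
  have hesymm : ‖(e.symm : (PiLp p fun _ : R × S => ℂ) →L[ℂ] PiLp p fun _ : V => ℂ)‖ ≤ 1 / Cp := by
    refine ContinuousLinearMap.opNorm_le_bound _ (by positivity) fun x => ?_
    have := hlower (e.symm x)
    rw [e.apply_symm_apply] at this
    rw [one_div_mul_eq_div, le_div_iff₀' hCp0]
    exact this
  obtain ⟨b, hb0, hb1, hb⟩ := exists_majorant_fixedPoint hmu0 hnu0 hCp0 hrp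
  rw [← hmu, ← hnu] at hPnorm
  have hmaj := sum_pow_mul_norm_rightInv_le P e hmu0 hnu0 hCp0 hPnorm hesymm hrp0.le hb0 hb1 hb
  obtain ⟨Q, hQ⟩ : ∃ Q, Q = P.leftInv e 0 := ⟨_, rfl⟩
  rw [← P.leftInv_eq_rightInv e 0 hP1, ← hQ] at hmaj
  have hQ0 : Q 0 = 0 := by
    rw [hQ]
    ext
    simp
  have hQK : ∀ n (x : R × S → ℂ), WithLp.toLp p (bornKinv α0 B G C K1inv n fun _ => x) =
      Q n fun _ => WithLp.toLp p x := fun n x => by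
    rw [hQ]
    exact (leftInv_apply_eq_bornKinv hP he n fun _ => x).symm
  have hpartial : ∀ n, ∑ k ∈ Finset.range n, ‖Q (k + 1)‖ * rp ^ (k + 1) ≤ b := fun n => by
    refine le_trans (le_of_eq ?_) (hmaj n)
    rw [Finset.sum_Ico_eq_sum_range]
    refine Finset.sum_congr rfl fun k _ => ?_
    rw [add_comm 1 k, mul_comm]
  have hQsum' : Summable fun n => ‖Q (n + 1)‖ * rp ^ (n + 1) :=
    summable_of_sum_range_le (fun n => by positivity) hpartial
  have hQsum : Summable fun n => ‖Q n‖ * rp ^ n := (summable_nat_add_iff 1).1 hQsum'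
  have htsum : ∀ x : R × S → ℂ,
      WithLp.toLp p (∑' j : ℕ, bornKinv α0 B G C K1inv (j + 1) fun _ => x) =
        ∑' j, Q (j + 1) fun _ => WithLp.toLp p x := fun x => by
    simp_rw [← hQK]
    exact (PiLp.continuousLinearEquiv p ℂ fun _ : V => ℂ).symm.map_tsum
  have hbound : ∀ χ : PiLp p fun _ : R × S => ℂ, ‖χ‖ < rp → ‖∑' j, Q (j + 1) fun _ => χ‖ ≤ M := by
    intro χ hχ
    rw [hM]
    refine le_csSup ⟨∑' n, ‖Q (n + 1)‖ * rp ^ (n + 1), ?_⟩ ⟨WithLp.ofLp χ, ?_, ?_⟩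
    · rintro t ⟨x, hx, rfl⟩
      rw [lpNorm_eq_norm_toLp, htsum]
      rw [lpNorm_eq_norm_toLp] at hx
      refine tsum_of_norm_bounded hQsum'.hasSum fun n => ?_
      refine ((Q (n + 1)).le_opNorm _).trans ?_
      simp only [Finset.prod_const, Finset.card_univ, Fintype.card_fin]
      gcongr
    · rwa [lpNorm_eq_norm_toLp, WithLp.toLp_ofLp]
    · rw [lpNorm_eq_norm_toLp, htsum, WithLp.toLp_ofLp]
  have hM0 : 0 ≤ M := (norm_nonneg _).trans (hbound 0 (by simpa using hrp0))
  have hmain := norm_tsum_sub_sum_range_le Q hQ0 hrp0 hτ0 hτ1 hQsum hbound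
    (φ := WithLp.toLp p φ) (by rwa [← lpNorm_eq_norm_toLp]) N
  rw [← htsum, ← lpNorm_eq_norm_toLp p φ] at hmain
  simp_rw [← hQK] at hmain
  rw [← WithLp.toLp_sum, ← WithLp.toLp_sub, ← lpNorm_eq_norm_toLp] at hmain
  refine lpNorm_top_le fun v => (norm_apply_le_lpNorm p _ v).trans (hmain.trans ?_)
  have hs0 : 0 ≤ lpNorm p φ / (τ * rp) := div_nonneg (lpNorm_nonneg _ _) (by positivity)
  have hs1 : lpNorm p φ / (τ * rp) < 1 := (div_lt_one (by positivity)).2 hφ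
  have hone : 1 ≤ (1 / (1 - τ)) ^ Fintype.card V :=
    one_le_pow₀ ((one_le_div (by linarith)).2 (by linarith))
  have hs2 : 0 ≤ 1 / (1 - lpNorm p φ / (τ * rp)) := one_div_nonneg.2 (by linarith)
  gcongr
  exact le_mul_of_one_le_right hM0 hone
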